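/- arXiv:1906.05432 — 3 statements merged into one kernel-verified Lean document; each statement's English description precedes it below -/
import Mathlib

section
/- For every smooth compactly supported function c : ℝ³ → E (E a finite-dimensional real inner product space), the weighted Hardy inequality ‖∇c‖_{L²(ℝ³)} ≥ (1/2)·‖ρ⁻¹·c‖_{L²(ℝ³)} holds, where ρ(x) = (1 + |x|²)^{1/2}. -/
open MeasureTheory
open scoped ENNReal

/-- The integral of the divergence of `h(x) x` vanishes when `h` is `C¹` with compact support. -/
lemma integral_card_mul_add_fderiv_self_eq_zero {ι : Type*} [Fintype ι]
    {h : EuclideanSpace ℝ ι → ℝ} (hh : ContDiff ℝ 1 h) (hs : HasCompactSupport h) :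
    ∫ x, (Fintype.card ι * h x + fderiv ℝ h x x) = 0 := by
  classical
  have hcoord (i : ι) : ContDiff ℝ 1 fun x : EuclideanSpace ℝ ι => x i :=
    (EuclideanSpace.proj (𝕜 := ℝ) i).contDiff
  let g : ι → EuclideanSpace ℝ ι → ℝ := fun i x => x i * h x
  have hg (i : ι) : ContDiff ℝ 1 (g i) := (hcoord i).mul hh
  have hgs (i : ι) : HasCompactSupport (g i) := hs.mul_left
  let e : ι → EuclideanSpace ℝ ι := fun i => EuclideanSpace.single i 1
  have hcont (i : ι) : Continuous fun x => fderiv ℝ (g i) x (e i) :=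
    ((hg i).continuous_fderiv one_ne_zero).clm_apply continuous_const
  have hint (i : ι) : Integrable fun x => fderiv ℝ (g i) x (e i) :=
    (hcont i).integrable_of_hasCompactSupport ((hgs i).fderiv_apply ℝ (e i))
  have hzero (i : ι) : ∫ x, fderiv ℝ (g i) x (e i) = 0 := by
    have := integral_mul_fderiv_eq_neg_fderiv_mul_of_integrable (𝕜 := ℝ) (μ := volume)
      (f := fun _ : EuclideanSpace ℝ ι => (1 : ℝ)) (g := g i) (v := e i)
      (by simp) (by simpa using hint i)
      (by simpa using (hg i).continuous.integrable_of_hasCompactSupport (hgs i))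
      (by fun_prop) fun x _ => (hg i).differentiable one_ne_zero x
    simpa using this
  have hderiv (i : ι) (x : EuclideanSpace ℝ ι) :
      fderiv ℝ (g i) x (e i) = h x + x i * fderiv ℝ h x (e i) := by
    have h1 : HasFDerivAt (fun x : EuclideanSpace ℝ ι => x i)
        (EuclideanSpace.proj (𝕜 := ℝ) i : EuclideanSpace ℝ ι →L[ℝ] ℝ) x :=
      (EuclideanSpace.proj (𝕜 := ℝ) i).hasFDerivAt
    have h2 := h1.mul ((hh.differentiable one_ne_zero) x).hasFDerivAt
    have h3 : fderiv ℝ (g i) x = _ := h2.fderiv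
    rw [h3]
    simp [e]
    ring
  have hsum (x : EuclideanSpace ℝ ι) :
      Fintype.card ι * h x + fderiv ℝ h x x = ∑ i, fderiv ℝ (g i) x (e i) := by
    have hx : ∑ i, x i • e i = x := by
      simpa [e] using (EuclideanSpace.basisFun ι ℝ).sum_repr x
    have h4 : fderiv ℝ h x x = ∑ i, x i * fderiv ℝ h x (e i) := by
      simpa using congrArg (fderiv ℝ h x) hx.symm
    simp only [hderiv, Finset.sum_add_distrib, h4]
    simp
  simp_rw [hsum]
  rw [integral_finsetSum _ fun i _ => hint i]
  simp [hzero]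

lemma eLpNorm_two_le_of_integral_sq_le {α F G : Type*} [MeasurableSpace α] {μ : Measure α}
    [NormedAddCommGroup F] [NormedAddCommGroup G] {f : α → F} {g : α → G}
    (hf : MemLp f 2 μ) (hg : MemLp g 2 μ) (h : ∫ x, ‖f x‖ ^ 2 ∂μ ≤ ∫ x, ‖g x‖ ^ 2 ∂μ) :
    eLpNorm f 2 μ ≤ eLpNorm g 2 μ := by
  rw [hf.eLpNorm_eq_integral_rpow_norm two_ne_zero ENNReal.ofNat_ne_top,
    hg.eLpNorm_eq_integral_rpow_norm two_ne_zero ENNReal.ofNat_ne_top]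
  simp only [ENNReal.toReal_ofNat, Real.rpow_ofNat]
  gcongr

/-- Completing the square with the vector field `x / (2 (1 + ‖x‖²))`; the term in parentheses is
the divergence of `‖c‖² x / (1 + ‖x‖²)` in dimension three. -/
lemma hardy_pointwise_bound {a d r p : ℝ} (hp : |p| ≤ a * (d * r)) :
    a ^ 2 / (1 + r ^ 2) / 4 ≤ d ^ 2 + (1 / 2) *
      (3 * (a ^ 2 / (1 + r ^ 2)) +
        (2 * p / (1 + r ^ 2) - 2 * r ^ 2 * a ^ 2 / (1 + r ^ 2) ^ 2)) := by
  have hpos : 0 < 1 + r ^ 2 := by positivity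
  have hp' := (abs_le.mp hp).1
  have hid : d ^ 2 + (1 / 2) *
      (3 * (a ^ 2 / (1 + r ^ 2)) +
        (2 * p / (1 + r ^ 2) - 2 * r ^ 2 * a ^ 2 / (1 + r ^ 2) ^ 2)) -
      a ^ 2 / (1 + r ^ 2) / 4 =
      (d - a * r / (2 * (1 + r ^ 2))) ^ 2 + (p + a * (d * r)) / (1 + r ^ 2) +
        5 * a ^ 2 / (4 * (1 + r ^ 2) ^ 2) := by
    field_simp
    ring
  have : 0 ≤ (p + a * (d * r)) / (1 + r ^ 2) := div_nonneg (by linarith) hpos.le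
  have : 0 ≤ 5 * a ^ 2 / (4 * (1 + r ^ 2) ^ 2) := by positivity
  nlinarith [sq_nonneg (d - a * r / (2 * (1 + r ^ 2)))]

lemma fderiv_norm_sq_div_one_add_norm_sq_self {V E : Type*} [NormedAddCommGroup V]
    [InnerProductSpace ℝ V] [NormedAddCommGroup E] [InnerProductSpace ℝ E] {c : V → E} {x : V}
    (hc : DifferentiableAt ℝ c x) :
    fderiv ℝ (fun y => ‖c y‖ ^ 2 / (1 + ‖y‖ ^ 2)) x x =
      2 * inner ℝ (c x) (fderiv ℝ c x x) / (1 + ‖x‖ ^ 2) -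
        2 * ‖x‖ ^ 2 * ‖c x‖ ^ 2 / (1 + ‖x‖ ^ 2) ^ 2 := by
  have hpos : 1 + ‖x‖ ^ 2 ≠ 0 := by positivity
  have h1 := hc.hasFDerivAt.norm_sq
  have h2 := ((hasFDerivAt_id (𝕜 := ℝ) x).norm_sq).const_add 1
  have h3 : HasFDerivAt (fun y => ‖c y‖ ^ 2 / (1 + ‖y‖ ^ 2)) _ x :=
    h1.mul ((hasDerivAt_inv hpos).comp_hasFDerivAt x h2)
  rw [h3.fderiv]
  simp
  field_simp
  ring

/-- **Hardy's inequality** on `ℝ³` (Lemma 3.2 of the paper):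
for every smooth compactly supported `c : ℝ³ → E`,
`‖∇c‖_{L²} ≥ (1/2) ‖ρ⁻¹ c‖_{L²}` where `ρ(x) = (1 + |x|²)^{1/2}`. -/
theorem hardy_inequality
    {E : Type*} [NormedAddCommGroup E] [InnerProductSpace ℝ E] [FiniteDimensional ℝ E]
    (c : EuclideanSpace ℝ (Fin 3) → E)
    (hc : ContDiff ℝ (⊤ : ℕ∞) c) (hsupp : HasCompactSupport c) :
    (1 / 2 : ℝ≥0∞) *
        eLpNorm (fun x => (Real.sqrt (1 + ‖x‖ ^ 2))⁻¹ • c x) 2 volume ≤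
      eLpNorm (fun x => fderiv ℝ c x) 2 volume := by
  have hc1 : ContDiff ℝ 1 c := hc.of_le (by exact_mod_cast le_top)
  have hpos (x : EuclideanSpace ℝ (Fin 3)) : 1 + ‖x‖ ^ 2 ≠ 0 := by positivity
  let h : EuclideanSpace ℝ (Fin 3) → ℝ := fun x => ‖c x‖ ^ 2 / (1 + ‖x‖ ^ 2)
  have hh : ContDiff ℝ 1 h :=
    (hc1.norm_sq ℝ).div (contDiff_const.add (contDiff_id.norm_sq ℝ)) hpos
  have hhs : HasCompactSupport h := hsupp.mono fun x hx => by
    contrapose! hx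
    simp_all [h]
  have hD : Continuous (fderiv ℝ c) := hc1.continuous_fderiv one_ne_zero
  have hDs : HasCompactSupport (fderiv ℝ c) := hsupp.fderiv ℝ
  have hf : Continuous fun x : EuclideanSpace ℝ (Fin 3) =>
      (1 / 2 : ℝ) • (Real.sqrt (1 + ‖x‖ ^ 2))⁻¹ • c x := by
    have := hc1.continuous
    refine continuous_const.smul (Continuous.smul (Continuous.inv₀ (by fun_prop) fun x => ?_) this)
    positivity
  have hfs : HasCompactSupport fun x : EuclideanSpace ℝ (Fin 3) =>
      (1 / 2 : ℝ) • (Real.sqrt (1 + ‖x‖ ^ 2))⁻¹ • c x := hsupp.smul_left.smul_left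
  have hhalf : (1 / 2 : ℝ≥0∞) *
      eLpNorm (fun x => (Real.sqrt (1 + ‖x‖ ^ 2))⁻¹ • c x) 2 volume =
      eLpNorm (fun x => (1 / 2 : ℝ) • (Real.sqrt (1 + ‖x‖ ^ 2))⁻¹ • c x) 2 volume := by
    have := eLpNorm_const_smul (1 / 2 : ℝ)
      (fun x => (Real.sqrt (1 + ‖x‖ ^ 2))⁻¹ • c x) 2 volume
    have h2 : ‖(1 / 2 : ℝ)‖ₑ = 1 / 2 := by
      rw [Real.enorm_eq_ofReal (by norm_num), ENNReal.ofReal_div_of_pos (by norm_num)]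
      simp
    rw [h2] at this
    exact this.symm
  rw [hhalf]
  refine eLpNorm_two_le_of_integral_sq_le (hf.memLp_of_hasCompactSupport hfs)
    (hD.memLp_of_hasCompactSupport hDs) ?_
  have hint1 : Integrable fun x => ‖fderiv ℝ c x‖ ^ 2 :=
    (hD.memLp_of_hasCompactSupport hDs).integrable_norm_pow two_ne_zero
  have hint2 : Integrable fun x => ((Fintype.card (Fin 3) : ℝ) * h x + fderiv ℝ h x x) :=
    ((hh.continuous.integrable_of_hasCompactSupport hhs).const_mul _).add
      (((hh.continuous_fderiv one_ne_zero).clm_apply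
        continuous_id).integrable_of_hasCompactSupport <| (hhs.fderiv ℝ).mono fun x hx => by
          contrapose! hx
          simp_all)
  calc ∫ x, ‖(1 / 2 : ℝ) • (Real.sqrt (1 + ‖x‖ ^ 2))⁻¹ • c x‖ ^ 2
      ≤ ∫ x, (‖fderiv ℝ c x‖ ^ 2 +
          (1 / 2) * ((Fintype.card (Fin 3) : ℝ) * h x + fderiv ℝ h x x)) := by
        refine integral_mono
          ((hf.memLp_of_hasCompactSupport hfs).integrable_norm_pow two_ne_zero)
          (hint1.add (hint2.const_mul _)) fun x => ?_
        have hp : |inner ℝ (c x) (fderiv ℝ c x x)| ≤ ‖c x‖ * (‖fderiv ℝ c x‖ * ‖x‖) :=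
          (abs_real_inner_le_norm _ _).trans (by gcongr; exact (fderiv ℝ c x).le_opNorm x)
        have hlhs : ‖(1 / 2 : ℝ) • (Real.sqrt (1 + ‖x‖ ^ 2))⁻¹ • c x‖ ^ 2 =
            ‖c x‖ ^ 2 / (1 + ‖x‖ ^ 2) / 4 := by
          rw [norm_smul, norm_smul, mul_pow, mul_pow, norm_inv, inv_pow, Real.norm_eq_abs (√_),
            sq_abs, Real.sq_sqrt (by positivity)]
          norm_num
          ring
        have hrhs := fderiv_norm_sq_div_one_add_norm_sq_self
          ((hc1.differentiable one_ne_zero) x)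
        simp only [hlhs, h, hrhs, Fintype.card_fin, Nat.cast_ofNat]
        exact hardy_pointwise_bound hp
    _ = ∫ x, ‖fderiv ℝ c x‖ ^ 2 := by
        rw [integral_add hint1 (hint2.const_mul _), integral_const_mul,
          integral_card_mul_add_fderiv_self_eq_zero hh hhs]
        simp
end

section
/- Let E, F, G be finite-dimensional real normed vector spaces and N₀ : E × F → G a bilinear map for which there is a constant C > 0 with ‖N₀(x, y)‖ ≤ C·‖x‖·‖y‖ for all x ∈ E, y ∈ F. Then there exists a constant C' > 0 such that for all smooth compactly supported functions γ₁ : ℝ³ → E and γ₂ : ℝ³ → F one has ‖N₀(γ₁, γ₂)‖_{L²(ℝ³)} ≤ C'·‖∇γ₁‖_{L²(ℝ³)}·( ‖γ₂‖_{L²(ℝ³)} + ‖∇γ₂‖_{L²(ℝ³)} ), where N₀(γ₁, γ₂)(x) = N₀(γ₁(x), γ₂(x)). -/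
open MeasureTheory
open scoped ENNReal

open scoped NNReal

/-- The `L^r` seminorm is at most the maximum of the `L^p` and `L^q` seminorms when `r` is a convex
combination of `p` and `q`. -/
theorem eLpNorm_le_max_of_convexCombination {α E : Type*} [MeasurableSpace α] {μ : Measure α}
    [NormedAddCommGroup E] {f : α → E} (hf : AEStronglyMeasurable f μ) {p q r : ℝ≥0}
    (hp : p ≠ 0) (hq : q ≠ 0) (hr : r ≠ 0) {s t : ℝ} (hs : 0 ≤ s) (ht : 0 ≤ t) (hst : s + t = 1)
    (hr_eq : (r : ℝ) = p * s + q * t) :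
    eLpNorm f r μ ≤ max (eLpNorm f p μ) (eLpNorm f q μ) := by
  set M := max (eLpNorm f p μ) (eLpNorm f q μ)
  have hr_pos : (0 : ℝ) < r := NNReal.coe_pos.2 (pos_iff_ne_zero.2 hr)
  rw [← ENNReal.rpow_le_rpow_iff hr_pos, eLpNorm_nnreal_pow_eq_lintegral hr]
  calc ∫⁻ x, ‖f x‖ₑ ^ (r : ℝ) ∂μ
      = ∫⁻ x, (‖f x‖ₑ ^ (p : ℝ)) ^ s * (‖f x‖ₑ ^ (q : ℝ)) ^ t ∂μ := by
        refine lintegral_congr fun x => ?_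
        rw [← ENNReal.rpow_mul, ← ENNReal.rpow_mul, hr_eq,
          ENNReal.rpow_add_of_nonneg _ _ (by positivity) (by positivity)]
    _ ≤ (∫⁻ x, ‖f x‖ₑ ^ (p : ℝ) ∂μ) ^ s * (∫⁻ x, ‖f x‖ₑ ^ (q : ℝ) ∂μ) ^ t :=
        ENNReal.lintegral_mul_norm_pow_le (hf.enorm.pow_const _) (hf.enorm.pow_const _) hs ht hst
    _ = (eLpNorm f p μ ^ (p : ℝ)) ^ s * (eLpNorm f q μ ^ (q : ℝ)) ^ t := by
        rw [eLpNorm_nnreal_pow_eq_lintegral hp, eLpNorm_nnreal_pow_eq_lintegral hq]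
    _ ≤ (M ^ (p : ℝ)) ^ s * (M ^ (q : ℝ)) ^ t := by
        gcongr
        · exact le_max_left _ _
        · exact le_max_right _ _
    _ = M ^ (r : ℝ) := by
        rw [← ENNReal.rpow_mul, ← ENNReal.rpow_mul, hr_eq,
          ENNReal.rpow_add_of_nonneg _ _ (by positivity) (by positivity)]

/-- The Sobolev inequality `‖u‖_{L⁶} ≤ K ‖∇u‖_{L²}` on `ℝ³`. -/
theorem exists_eLpNorm_six_le_eLpNorm_fderiv_two (E : Type*) [NormedAddCommGroup E]
    [NormedSpace ℝ E] [FiniteDimensional ℝ E] :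
    ∃ K : ℝ≥0, ∀ u : EuclideanSpace ℝ (Fin 3) → E, ContDiff ℝ 1 u → HasCompactSupport u →
      eLpNorm u 6 volume ≤ K * eLpNorm (fderiv ℝ u) 2 volume :=
  ⟨_, fun _ hu h2u => eLpNorm_le_eLpNorm_fderiv_of_eq (p := 2) (p' := 6) volume hu h2u
    (by norm_num) (by simp) (by norm_num)⟩

instance : ENNReal.HolderTriple 6 3 2 where
  inv_add_inv_eq_inv := by
    rw [← ENNReal.toReal_eq_toReal_iff' (by simp) (by simp), ENNReal.toReal_add (by simp) (by simp)]
    norm_num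

/-- The multiplication lemma (Lemma 3.10 of the paper): for a pointwise-bounded
bilinear map `N₀ : E × F → G` there is a constant `C'` such that for all smooth
compactly supported `γ₁ : ℝ³ → E`, `γ₂ : ℝ³ → F`,
`‖N₀(γ₁, γ₂)‖_{L²} ≤ C' ‖∇γ₁‖_{L²} (‖γ₂‖_{L²} + ‖∇γ₂‖_{L²})`. -/
theorem multiplication_lemma
    {E F G : Type*}
    [NormedAddCommGroup E] [NormedSpace ℝ E] [FiniteDimensional ℝ E]
    [NormedAddCommGroup F] [NormedSpace ℝ F] [FiniteDimensional ℝ F]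
    [NormedAddCommGroup G] [NormedSpace ℝ G] [FiniteDimensional ℝ G]
    (N₀ : E →ₗ[ℝ] F →ₗ[ℝ] G) (C : ℝ) (hC : 0 < C)
    (hbound : ∀ (x : E) (y : F), ‖N₀ x y‖ ≤ C * ‖x‖ * ‖y‖) :
    ∃ C' : ℝ, 0 < C' ∧
      ∀ (γ₁ : EuclideanSpace ℝ (Fin 3) → E) (γ₂ : EuclideanSpace ℝ (Fin 3) → F),
        ContDiff ℝ (⊤ : ℕ∞) γ₁ → HasCompactSupport γ₁ →
        ContDiff ℝ (⊤ : ℕ∞) γ₂ → HasCompactSupport γ₂ →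
        eLpNorm (fun x => N₀ (γ₁ x) (γ₂ x)) 2 volume ≤
          ENNReal.ofReal C' * eLpNorm (fun x => fderiv ℝ γ₁ x) 2 volume *
            (eLpNorm γ₂ 2 volume + eLpNorm (fun x => fderiv ℝ γ₂ x) 2 volume) := by
  obtain ⟨K₁, hK₁⟩ := exists_eLpNorm_six_le_eLpNorm_fderiv_two E
  obtain ⟨K₂, hK₂⟩ := exists_eLpNorm_six_le_eLpNorm_fderiv_two F
  lift C to ℝ≥0 using hC.le
  have hC_pos : 0 < C := NNReal.coe_pos.1 hC
  refine ⟨(C * (K₁ + 1) * (K₂ + 1) : ℝ≥0), NNReal.coe_pos.2 (by positivity),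
    fun γ₁ γ₂ h₁ hc₁ h₂ hc₂ => ?_⟩
  have hmeas₁ : AEStronglyMeasurable γ₁ (volume : Measure (EuclideanSpace ℝ (Fin 3))) :=
    (h₁.continuous.stronglyMeasurable_of_hasCompactSupport hc₁).aestronglyMeasurable
  have hmeas₂ : AEStronglyMeasurable γ₂ (volume : Measure (EuclideanSpace ℝ (Fin 3))) :=
    (h₂.continuous.stronglyMeasurable_of_hasCompactSupport hc₂).aestronglyMeasurable
  have hSobolev₁ := hK₁ γ₁ (h₁.of_le (by norm_cast)) hc₁
  have hSobolev₂ := hK₂ γ₂ (h₂.of_le (by norm_cast)) hc₂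
  have hHolder : eLpNorm (fun x => N₀ (γ₁ x) (γ₂ x)) 2 volume ≤
      C * eLpNorm γ₁ 6 volume * eLpNorm γ₂ 3 volume :=
    eLpNorm_le_eLpNorm_mul_eLpNorm_of_nnnorm hmeas₁ hmeas₂ (fun x y => N₀ x y) C
      (.of_forall fun x => hbound (γ₁ x) (γ₂ x))
  have hInterp : eLpNorm γ₂ 3 volume ≤ max (eLpNorm γ₂ 2 volume) (eLpNorm γ₂ 6 volume) :=
    eLpNorm_le_max_of_convexCombination (p := 2) (q := 6) (r := 3) (s := 3 / 4) (t := 1 / 4)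
      hmeas₂ (by simp) (by simp) (by simp) (by norm_num) (by norm_num) (by norm_num)
      (by norm_num)
  rw [ENNReal.ofReal_coe_nnreal]
  push_cast
  set A := eLpNorm (fun x => fderiv ℝ γ₁ x) 2 volume
  set B := eLpNorm γ₂ 2 volume
  set D := eLpNorm (fun x => fderiv ℝ γ₂ x) 2 volume
  have hThree : eLpNorm γ₂ 3 volume ≤ (K₂ + 1) * (B + D) := by
    refine hInterp.trans (max_le ?_ (hSobolev₂.trans ?_))
    · exact (one_mul B).symm.trans_le (mul_le_mul' le_add_self le_self_add)
    · exact mul_le_mul' le_self_add le_add_self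
  calc eLpNorm (fun x => N₀ (γ₁ x) (γ₂ x)) 2 volume
      ≤ C * (K₁ * A) * ((K₂ + 1) * (B + D)) :=
        hHolder.trans (mul_le_mul' (mul_le_mul_right hSobolev₁ _) hThree)
    _ ≤ C * ((K₁ + 1) * A) * ((K₂ + 1) * (B + D)) := by gcongr; exact le_self_add
    _ = C * (K₁ + 1) * (K₂ + 1) * A * (B + D) := by ring
end

section
/- Let 𝔤 be a real Lie algebra. Define I, J, K : 𝔤⁴ → 𝔤⁴ by I(A) = (−A₁, A₀, −A₃, A₂), J(A) = (−A₂, A₃, A₀, −A₁), K(A) = (−A₃, −A₂, A₁, A₀), and on 𝔤⁴ × 𝔤⁴ the maps I₁(A,B) = (−B, A), L₂(A,B) = (LA, −LB) and L₃(A,B) = (LB, LA) for each L ∈ {I, J, K}. Then each of the seven maps I₁, I₂, I₃, J₂, J₃, K₂, K₃ maps the common zero set Q of the seven moment maps μ₁, μ_{I₂}, μ_{J₂}, μ_{K₂}, μ_{I₃}, μ_{J₃}, μ_{K₃} into itself. -/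
section MomentMaps

variable {g : Type*} [LieRing g] [LieAlgebra ℝ g]

/-- `μ₁(A,B) = Σᵢ [Aᵢ, Bᵢ]`. -/
def mu1 (A B : Fin 4 → g) : g :=
  ⁅A 0, B 0⁆ + ⁅A 1, B 1⁆ + ⁅A 2, B 2⁆ + ⁅A 3, B 3⁆

/-- `μ_{I₂}(A,B) = [A₀,A₁] + [A₂,A₃] − [B₀,B₁] − [B₂,B₃]`. -/
def muI2 (A B : Fin 4 → g) : g :=
  ⁅A 0, A 1⁆ + ⁅A 2, A 3⁆ - ⁅B 0, B 1⁆ - ⁅B 2, B 3⁆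

/-- `μ_{J₂}(A,B) = [A₀,A₂] + [A₃,A₁] − [B₀,B₂] − [B₃,B₁]`. -/
def muJ2 (A B : Fin 4 → g) : g :=
  ⁅A 0, A 2⁆ + ⁅A 3, A 1⁆ - ⁅B 0, B 2⁆ - ⁅B 3, B 1⁆

/-- `μ_{K₂}(A,B) = [A₀,A₃] + [A₁,A₂] − [B₀,B₃] − [B₁,B₂]`. -/
def muK2 (A B : Fin 4 → g) : g :=
  ⁅A 0, A 3⁆ + ⁅A 1, A 2⁆ - ⁅B 0, B 3⁆ - ⁅B 1, B 2⁆

/-- `μ_{I₃}(A,B) = [A₀,B₁] + [A₂,B₃] − [A₁,B₀] − [A₃,B₂]`. -/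
def muI3 (A B : Fin 4 → g) : g :=
  ⁅A 0, B 1⁆ + ⁅A 2, B 3⁆ - ⁅A 1, B 0⁆ - ⁅A 3, B 2⁆

/-- `μ_{J₃}(A,B) = [A₀,B₂] + [A₃,B₁] − [A₂,B₀] − [A₁,B₃]`. -/
def muJ3 (A B : Fin 4 → g) : g :=
  ⁅A 0, B 2⁆ + ⁅A 3, B 1⁆ - ⁅A 2, B 0⁆ - ⁅A 1, B 3⁆

/-- `μ_{K₃}(A,B) = [A₀,B₃] + [A₁,B₂] − [A₃,B₀] − [A₂,B₁]`. -/
def muK3 (A B : Fin 4 → g) : g :=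
  ⁅A 0, B 3⁆ + ⁅A 1, B 2⁆ - ⁅A 3, B 0⁆ - ⁅A 2, B 1⁆

/-- The common zero set `Q` of the seven moment maps. -/
def Qset : Set ((Fin 4 → g) × (Fin 4 → g)) :=
  {p | mu1 p.1 p.2 = 0 ∧ muI2 p.1 p.2 = 0 ∧ muJ2 p.1 p.2 = 0 ∧ muK2 p.1 p.2 = 0 ∧
    muI3 p.1 p.2 = 0 ∧ muJ3 p.1 p.2 = 0 ∧ muK3 p.1 p.2 = 0}

/-- Left quaternionic multiplication by `i`: `I(A) = (−A₁, A₀, −A₃, A₂)`. -/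
def Iq (A : Fin 4 → g) : Fin 4 → g := ![-A 1, A 0, -A 3, A 2]

/-- Left quaternionic multiplication by `j`: `J(A) = (−A₂, A₃, A₀, −A₁)`. -/
def Jq (A : Fin 4 → g) : Fin 4 → g := ![-A 2, A 3, A 0, -A 1]

/-- Left quaternionic multiplication by `k`: `K(A) = (−A₃, −A₂, A₁, A₀)`. -/
def Kq (A : Fin 4 → g) : Fin 4 → g := ![-A 3, -A 2, A 1, A 0]

end MomentMaps

/-- The flat-model content of Proposition 4.4 of the paper: each of the seven
complex structures `I₁, I₂, I₃, J₂, J₃, K₂, K₃` on `𝔤⁴ × 𝔤⁴` maps the common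
zero set `Q` of the seven moment maps into itself. -/
theorem complex_structures_preserve_zero_set
    {g : Type*} [LieRing g] [LieAlgebra ℝ g]
    (p : (Fin 4 → g) × (Fin 4 → g)) (hp : p ∈ Qset) :
    ((-p.2, p.1) ∈ Qset) ∧
    ((Iq p.1, -(Iq p.2)) ∈ Qset) ∧ ((Iq p.2, Iq p.1) ∈ Qset) ∧
    ((Jq p.1, -(Jq p.2)) ∈ Qset) ∧ ((Jq p.2, Jq p.1) ∈ Qset) ∧
    ((Kq p.1, -(Kq p.2)) ∈ Qset) ∧ ((Kq p.2, Kq p.1) ∈ Qset) := by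
  obtain ⟨A, B⟩ := p
  obtain ⟨h₁, hI₂, hJ₂, hK₂, hI₃, hJ₃, hK₃⟩ := hp
  simp only [mu1, muI2, muJ2, muK2, muI3, muJ3, muK3] at h₁ hI₂ hJ₂ hK₂ hI₃ hJ₃ hK₃
  have skew (x y : g) : ⁅x, y⁆ = -⁅y, x⁆ := (lie_skew x y).symm
  refine ⟨?_, ?_, ?_, ?_, ?_, ?_, ?_⟩ <;>
    refine ⟨?_, ?_, ?_, ?_, ?_, ?_, ?_⟩ <;>
    simp [mu1, muI2, muJ2, muK2, muI3, muJ3, muK3, Iq, Jq, Kq] <;>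
    grind only
end
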